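/- Let a ∈ B(m,k) be a nonzero weight-homogeneous element with w_i(a) ∈ ℤ (an integer, not a half-integer). If a·R_i ≠ 0 then a·U_i ≠ 0; similarly, if R_i·a ≠ 0 then U_i·a ≠ 0. -/

import Mathlib

/-- Idempotent states: `k`-element subsets of `{0,1,...,m}`. -/
abbrev IdemState (m k : ℕ) := {x : Finset (Fin (m + 1)) // x.card = k}

/-- The weight `v^x` at coordinate `c : Fin m`, representing the paper's
`v^x_{c+1} = #{a ∈ x : a ≥ c+1}` (coordinate `c` corresponds to the strand
labelled `c+1`). -/
def vwt {m : ℕ} (x : Finset (Fin (m + 1))) (c : Fin m) : ℕ :=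
  (x.filter (fun a => (c : ℕ) < a.val)).card

/-- Twice the minimal relative weight: `2·w^{x,y}_{c+1} = |v^x_{c+1} − v^y_{c+1}|`. -/
def wnum {m : ℕ} (x y : Finset (Fin (m + 1))) (c : Fin m) : ℕ :=
  ((vwt x c : ℤ) - (vwt y c : ℤ)).natAbs

/-- Basis elements of `B₀(m,k)`: a pair of idempotent states together with a
monomial `U_1^{s_1} ⋯ U_m^{s_m}` (recorded by its exponents); the basis element
is `φ^{x,y}(U^s)`. -/
structure BGen (m k : ℕ) where
  l : IdemState m k
  r : IdemState m k
  s : Fin m → ℕ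
deriving DecidableEq

/-- The exponents `t_i = w^{x,y}_i + w^{y,z}_i − w^{x,z}_i` of the correction
monomial `g^{x,y,z} = U_1^{t_1} ⋯ U_m^{t_m}`. -/
def texp {m k : ℕ} (x y z : IdemState m k) (c : Fin m) : ℕ :=
  (wnum x.1 y.1 c + wnum y.1 z.1 c - wnum x.1 z.1 c) / 2

/-- The product of two basis elements of `B₀(m,k)`:
`φ^{x,y}(U^s) * φ^{y',z}(U^{s'})` is zero (i.e. `none`) unless `y = y'`, in
which case it equals `φ^{x,z}(U^s · U^{s'} · g^{x,y,z})`. -/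
def mulBGen {m k : ℕ} (a b : BGen m k) : Option (BGen m k) :=
  if a.r = b.l then
    some ⟨a.l, b.r, fun c => a.s c + b.s c + texp a.l a.r b.r c⟩
  else none

/-- The underlying `F₂`-vector space of the algebra `B₀(m,k)`: formal `F₂`-linear
combinations of the basis elements `φ^{x,y}(U^s)`. -/
def B0 (m k : ℕ) : Type := BGen m k →₀ ZMod 2

noncomputable instance {m k : ℕ} : AddCommGroup (B0 m k) :=
  inferInstanceAs (AddCommGroup (BGen m k →₀ ZMod 2))

/-- View an element of `B₀(m,k)` as a finitely supported function. -/
def B0.toF {m k : ℕ} (f : B0 m k) : BGen m k →₀ ZMod 2 := f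

/-- The multiplication of `B₀(m,k)`, the bilinear extension of `mulBGen`. -/
noncomputable def mulB {m k : ℕ} (f g : B0 m k) : B0 m k :=
  (B0.toF f).sum fun a ca =>
    (B0.toF g).sum fun b cb =>
      match mulBGen a b with
      | some c => Finsupp.single c (ca * cb)
      | none => 0

noncomputable instance {m k : ℕ} : Mul (B0 m k) := ⟨mulB⟩

/-- The basis element `φ^{x,y}(U^s)` of `B₀(m,k)`. -/
noncomputable def bElt {m k : ℕ} (g : BGen m k) : B0 m k := Finsupp.single g 1

/-- The basic idempotent `I_x ∈ B₀(m,k)`. -/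
noncomputable def idemElt {m k : ℕ} (x : IdemState m k) : B0 m k :=
  bElt ⟨x, x, fun _ => 0⟩

/-- The central element `U_i = Σ_x φ^{x,x}(U_i)`; the index `i : Fin m`
corresponds to the paper's `U_{i+1}`. -/
noncomputable def UElt {m k : ℕ} (i : Fin m) : B0 m k :=
  ∑ x : IdemState m k, bElt (⟨x, x, fun c => if c = i then 1 else 0⟩ : BGen m k)

/-- The right-shift `R = Σ R^x`, moving an occupied position from `i` to `i+1`
(the paper's `R_{i+1}`). -/
noncomputable def RElt {m k : ℕ} (i : Fin m) : B0 m k :=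
  ∑ p : IdemState m k × IdemState m k,
    if i.castSucc ∈ p.1.1 ∧ i.succ ∉ p.1.1 ∧
        p.2.1 = insert i.succ (p.1.1.erase i.castSucc) then
      bElt (⟨p.1, p.2, fun _ => 0⟩ : BGen m k)
    else 0

/-- The left-shift `L = Σ L^y`, moving an occupied position from `i+1` to `i`
(the paper's `L_{i+1}`). -/
noncomputable def LElt {m k : ℕ} (i : Fin m) : B0 m k :=
  ∑ p : IdemState m k × IdemState m k,
    if i.succ ∈ p.1.1 ∧ i.castSucc ∉ p.1.1 ∧
        p.2.1 = insert i.castSucc (p.1.1.erase i.succ) then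
      bElt (⟨p.1, p.2, fun _ => 0⟩ : BGen m k)
    else 0

/-- The generating set of the two-sided ideal `J`: the elements
`L_{i+1}·L_i`, `R_i·R_{i+1}`, and `I_x·U_j` for states `x` with
`x ∩ {j−1, j} = ∅`. -/
def JGenerators (m k : ℕ) : Set (B0 m k) :=
  {z | ∃ i i' : Fin m, (i' : ℕ) = (i : ℕ) + 1 ∧
        (z = LElt i' * LElt i ∨ z = RElt i * RElt i')} ∪
  {z | ∃ (j : Fin m) (x : IdemState m k),
        j.castSucc ∉ x.1 ∧ j.succ ∉ x.1 ∧ z = idemElt x * UElt j}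

/-- The two-sided ideal `J ⊆ B₀(m,k)` generated by `JGenerators`:  since
`B₀(m,k)` is unital, it is the additive subgroup generated by all products
`a·g·b` with `g` a generator. -/
noncomputable def JIdeal (m k : ℕ) : AddSubgroup (B0 m k) :=
  AddSubgroup.closure {z | ∃ g ∈ JGenerators m k, ∃ a b : B0 m k, z = a * g * b}

/-- The map `φ^{x,y} : F₂[U_1,...,U_m] → I_x·B₀(m,k)·I_y`. -/
noncomputable def phiMap {m k : ℕ} (x y : IdemState m k)
    (p : MvPolynomial (Fin m) (ZMod 2)) : B0 m k :=
  ∑ d ∈ p.support, Finsupp.single (⟨x, y, fun c => d c⟩ : BGen m k) (MvPolynomial.coeff d p)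

/-- Two idempotent states are *far* if some pair of corresponding entries of
their increasing enumerations differs by more than `1`. -/
def FarStates {m k : ℕ} (x y : IdemState m k) : Prop :=
  ∃ j : Fin k,
    1 < |(((x.1.orderIsoOfFin x.2 j : Fin (m + 1)) : ℕ) : ℤ) -
          (((y.1.orderIsoOfFin y.2 j : Fin (m + 1)) : ℕ) : ℤ)|

/-- `[i+1, j]` is a *generating interval* for `(x, y)`: here `0 ≤ i < j ≤ m`,
`i, j ∉ x ∩ y`, every `t` with `i < t < j` lies in `x ∩ y`, and `w^{x,y}_t = 0`
for all `i+1 ≤ t ≤ j` (a paper index `t` corresponds to the coordinate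
`c = t − 1 : Fin m`). -/
def GenInterval {m k : ℕ} (x y : IdemState m k) (i j : ℕ) : Prop :=
  i < j ∧ j ≤ m ∧
  (∀ a : Fin (m + 1), (a.val = i ∨ a.val = j) → ¬(a ∈ x.1 ∧ a ∈ y.1)) ∧
  (∀ a : Fin (m + 1), i < a.val → a.val < j → a ∈ x.1 ∧ a ∈ y.1) ∧
  (∀ c : Fin m, i ≤ (c : ℕ) → (c : ℕ) < j → wnum x.1 y.1 c = 0)

/-- The monomial `U_{i+1} ⋯ U_j` associated to a generating interval. -/
noncomputable def intervalMonomial {m : ℕ} (i j : ℕ) : MvPolynomial (Fin m) (ZMod 2) :=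
  ∏ c ∈ Finset.univ.filter (fun c : Fin m => i ≤ (c : ℕ) ∧ (c : ℕ) < j),
    MvPolynomial.X c

open Classical in
/-- The ideal `I(x,y) ⊆ F₂[U_1,...,U_m]`: everything if `x` and `y` are far,
and otherwise the ideal generated by the monomials of the generating intervals
for `(x,y)`. -/
noncomputable def IIdeal {m k : ℕ} (x y : IdemState m k) :
    Ideal (MvPolynomial (Fin m) (ZMod 2)) :=
  if FarStates x y then ⊤
  else Ideal.span {q | ∃ i j : ℕ, GenInterval x y i j ∧ q = intervalMonomial i j}

/-- An integer sequence `u` indexed by strands is a height function when it descends from `k` to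
`0` in steps of size at most one between the strands `0` and `m + 1`. -/
structure IsHeight (m k : ℕ) (u : ℤ → ℤ) : Prop where
  succ_le : ∀ a, u (a + 1) ≤ u a
  le_succ : ∀ a, u a ≤ u (a + 1) + 1
  left : ∀ a ≤ 0, u a = k
  right : ∀ a, (m : ℤ) < a → u a = 0

namespace IsHeight

variable {m k : ℕ} {u v w : ℤ → ℤ}

lemma antitone (hu : IsHeight m k u) : Antitone u :=
  antitone_int_of_succ_le hu.succ_le

lemma nonneg (hu : IsHeight m k u) (a : ℤ) : 0 ≤ u a := by
  rw [← hu.right (max a (m + 1)) (by omega)]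
  exact hu.antitone (le_max_left _ _)

lemma le_top (hu : IsHeight m k u) (a : ℤ) : u a ≤ k := by
  rw [← hu.left (min a 0) (by omega)]
  exact hu.antitone (min_le_left _ _)

lemma pred (hu : IsHeight m k u) (a : ℤ) : u a ≤ u (a - 1) ∧ u (a - 1) ≤ u a + 1 := by
  have h₁ := hu.succ_le (a - 1)
  have h₂ := hu.le_succ (a - 1)
  rw [sub_add_cancel] at h₁ h₂
  exact ⟨h₁, h₂⟩

end IsHeight

/-- The height function obtained by reversing the order of the strands. -/
def reflectHeight (m k : ℕ) (u : ℤ → ℤ) (a : ℤ) : ℤ := k - u (m + 1 - a)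

lemma IsHeight.reflect {m k : ℕ} {u : ℤ → ℤ} (hu : IsHeight m k u) :
    IsHeight m k (reflectHeight m k u) where
  succ_le a := by
    have := (hu.pred (m + 1 - a)).1
    rw [sub_sub] at this
    simp only [reflectHeight, ← sub_sub] at *
    omega
  le_succ a := by
    have := (hu.pred (m + 1 - a)).2
    rw [sub_sub] at this
    simp only [reflectHeight, ← sub_sub] at *
    omega
  left a ha := by
    have := hu.right (m + 1 - a) (by omega)
    simp only [reflectHeight]
    omega
  right a ha := by
    have := hu.left (m + 1 - a) (by omega)
    simp only [reflectHeight]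
    omega

/-- The position between the strands `a` and `a + 1` is occupied. -/
def Occ (u : ℤ → ℤ) (a : ℤ) : Prop := u (a + 1) < u a

/-- Far pairs of states, in terms of height functions. -/
def FarHeights (u v : ℤ → ℤ) : Prop := ∃ c, u c < v (c + 1) ∨ v c < u (c + 1)

/-- The strands `p + 1, …, q` form a generating interval for a pair of height functions. -/
structure HeightInterval (u v : ℤ → ℤ) (p q : ℤ) : Prop where
  lt : p < q
  left : ¬(Occ u p ∧ Occ v p)
  right : ¬(Occ u q ∧ Occ v q)
  inner : ∀ a, p < a → a < q → Occ u a ∧ Occ v a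
  eq : ∀ c, p < c → c ≤ q → u c = v c

/-- The vanishing criterion for a basis element with end states of heights `u` and `v`, in which
exactly the variables of the strands in `S` occur. -/
def Vanishes (u v : ℤ → ℤ) (S : Set ℤ) : Prop :=
  FarHeights u v ∨ ∃ p q, HeightInterval u v p q ∧ ∀ c, p < c → c ≤ q → c ∈ S

lemma FarHeights.symm {u v : ℤ → ℤ} (h : FarHeights u v) : FarHeights v u :=
  h.imp fun _ => Or.symm

lemma HeightInterval.symm {u v : ℤ → ℤ} {p q : ℤ} (h : HeightInterval u v p q) :
    HeightInterval v u p q :=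
  ⟨h.lt, fun h' => h.left h'.symm, fun h' => h.right h'.symm,
    fun a h₁ h₂ => (h.inner a h₁ h₂).symm, fun c h₁ h₂ => (h.eq c h₁ h₂).symm⟩

lemma Vanishes.symm {u v : ℤ → ℤ} {S : Set ℤ} (h : Vanishes u v S) : Vanishes v u S :=
  h.imp FarHeights.symm fun ⟨p, q, h₁, h₂⟩ => ⟨p, q, h₁.symm, h₂⟩

lemma Vanishes.mono {u v : ℤ → ℤ} {S T : Set ℤ} (h : Vanishes u v S) (hST : S ⊆ T) :
    Vanishes u v T :=
  h.imp_right fun ⟨p, q, h₁, h₂⟩ => ⟨p, q, h₁, fun c hc hc' => hST (h₂ c hc hc')⟩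

section Reflect

variable {m k : ℕ} {u v : ℤ → ℤ} {p q : ℤ}

lemma occ_reflect {a : ℤ} : Occ (reflectHeight m k u) a ↔ Occ u (m - a) := by
  have h₁ : (m + 1 - (a + 1) : ℤ) = m - a := by ring
  have h₂ : (m + 1 - a : ℤ) = m - a + 1 := by ring
  simp only [Occ, reflectHeight, h₁, h₂]
  omega

lemma FarHeights.of_reflect (h : FarHeights (reflectHeight m k u) (reflectHeight m k v)) :
    FarHeights u v := by
  obtain ⟨c, hc⟩ := h
  refine ⟨m - c, ?_⟩
  have h₁ : (m + 1 - (c + 1) : ℤ) = m - c := by ring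
  have h₂ : (m + 1 - c : ℤ) = m - c + 1 := by ring
  simp only [reflectHeight, h₁, h₂] at hc
  omega

lemma HeightInterval.of_reflect
    (h : HeightInterval (reflectHeight m k u) (reflectHeight m k v) p q) :
    HeightInterval u v (m - q) (m - p) where
  lt := by have := h.lt; omega
  left := by simpa only [occ_reflect] using h.right
  right := by simpa only [occ_reflect] using h.left
  inner a h₁ h₂ := by
    simpa only [occ_reflect, sub_sub_cancel] using h.inner (m - a) (by omega) (by omega)
  eq c h₁ h₂ := by
    have := h.eq (m + 1 - c) (by omega) (by omega)
    simp only [reflectHeight, sub_sub_cancel] at this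
    omega

end Reflect

section Walk

variable {m k : ℕ} {u v w : ℤ → ℤ} {E : Set ℤ}

/-- Walking to the right along strands of equal height until a position is not occupied in
both states. -/
lemma exists_right_end (hu : IsHeight m k u) (hw : IsHeight m k w)
    (hE : ∀ i ∈ E, max (u (i + 1)) (w (i + 1)) < max (u i) (w i) → i + 1 ∈ E)
    {i : ℤ} (hi : i ∈ E) (huw : u i = w i) :
    ∃ q, i ≤ q ∧ ¬(Occ u q ∧ Occ w q) ∧ (∀ a, i ≤ a → a < q → Occ u a ∧ Occ w a) ∧
      ∀ c, i ≤ c → c ≤ q → u c = w c ∧ c ∈ E := by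
  by_cases h : Occ u i ∧ Occ w i
  · have h₁ := hu.le_succ i
    have h₂ := hw.le_succ i
    have h₃ := hu.nonneg (i + 1)
    obtain ⟨h₄, h₅⟩ := h
    unfold Occ at h₄ h₅
    obtain ⟨q, hq, hq₁, hq₂, hq₃⟩ :=
      exists_right_end hu hw hE (hE i hi (by omega)) (by omega)
    refine ⟨q, by omega, hq₁, fun a ha ha' => ?_, fun c hc hc' => ?_⟩
    · rcases ha.eq_or_lt with rfl | ha
      · exact ⟨h₄, h₅⟩
      · exact hq₂ a (by omega) ha'
    · rcases hc.eq_or_lt with rfl | hc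
      · exact ⟨huw, hi⟩
      · exact hq₃ c (by omega) hc'
  · exact ⟨i, le_rfl, h, fun a ha ha' => by omega, fun c hc hc' => by
      obtain rfl : i = c := by omega
      exact ⟨huw, hi⟩⟩
termination_by (u i).toNat
decreasing_by unfold Occ at h₄; omega

lemma exists_interval_right (hu : IsHeight m k u) (hw : IsHeight m k w)
    (hfar : ¬FarHeights u w)
    (hE : ∀ i ∈ E, max (u (i + 1)) (w (i + 1)) < max (u i) (w i) → i + 1 ∈ E)
    {i : ℤ} (hi : i ∈ E) (huw : u i ≠ w i ∨ ¬(Occ u (i - 1) ∧ Occ w (i - 1))) :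
    ∃ p q, HeightInterval u w p q ∧ ∀ c, p < c → c ≤ q → c ∈ E := by
  by_cases h : u i = w i
  · obtain ⟨q, hq, hq₁, hq₂, hq₃⟩ := exists_right_end hu hw hE hi h
    refine ⟨i - 1, q, ⟨by omega, by tauto, hq₁, fun a h₁ h₂ => hq₂ a (by omega) h₂,
      fun c h₁ h₂ => (hq₃ c (by omega) h₂).1⟩, fun c h₁ h₂ => (hq₃ c (by omega) h₂).2⟩
  · have hf : ¬(u i < w (i + 1) ∨ w i < u (i + 1)) := fun hf => hfar ⟨i, hf⟩
    have h₁ := hu.le_succ i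
    have h₂ := hw.le_succ i
    have h₃ := hu.succ_le i
    have h₄ := hw.succ_le i
    have h₅ := hu.nonneg (i + 1)
    have h₆ := hw.nonneg (i + 1)
    refine exists_interval_right hu hw hfar hE (hE i hi (by omega)) ?_
    simp only [Occ, add_sub_cancel_right]
    omega
termination_by (max (u i) (w i)).toNat
decreasing_by omega

lemma reflect_step
    (hE : ∀ i ∈ E, min (u i) (w i) < min (u (i - 1)) (w (i - 1)) → i - 1 ∈ E) :
    ∀ i ∈ {a | (m : ℤ) + 1 - a ∈ E},
      max (reflectHeight m k u (i + 1)) (reflectHeight m k w (i + 1)) <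
        max (reflectHeight m k u i) (reflectHeight m k w i) →
      i + 1 ∈ {a | (m : ℤ) + 1 - a ∈ E} := by
  intro i hi h
  have h₁ : (m + 1 - (i + 1) : ℤ) = m + 1 - i - 1 := by ring
  have := hE _ hi
  simp only [reflectHeight, Set.mem_ofPred_eq, h₁] at *
  exact this (by omega)

/-- Walking to the left along strands of equal height until a position is not occupied in
both states. -/
lemma exists_left_end (hu : IsHeight m k u) (hw : IsHeight m k w)
    (hE : ∀ i ∈ E, min (u i) (w i) < min (u (i - 1)) (w (i - 1)) → i - 1 ∈ E)
    {i : ℤ} (hi : i ∈ E) (huw : u i = w i) :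
    ∃ p, p < i ∧ ¬(Occ u p ∧ Occ w p) ∧ (∀ a, p < a → a < i → Occ u a ∧ Occ w a) ∧
      ∀ c, p < c → c ≤ i → u c = w c ∧ c ∈ E := by
  obtain ⟨q, hq, hq₁, hq₂, hq₃⟩ := exists_right_end hu.reflect hw.reflect (reflect_step hE)
    (i := m + 1 - i) (by simpa using hi) (by simpa [reflectHeight] using huw)
  simp only [occ_reflect] at hq₁ hq₂
  refine ⟨m - q, by omega, hq₁, fun a h₁ h₂ => ?_, fun c h₁ h₂ => ?_⟩
  · simpa using hq₂ (m - a) (by omega) (by omega)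
  · simpa [reflectHeight] using hq₃ (m + 1 - c) (by omega) (by omega)

lemma exists_interval_left (hu : IsHeight m k u) (hw : IsHeight m k w)
    (hfar : ¬FarHeights u w)
    (hE : ∀ i ∈ E, min (u i) (w i) < min (u (i - 1)) (w (i - 1)) → i - 1 ∈ E)
    {i : ℤ} (hi : i ∈ E) (huw : u i ≠ w i ∨ ¬(Occ u i ∧ Occ w i)) :
    ∃ p q, HeightInterval u w p q ∧ ∀ c, p < c → c ≤ q → c ∈ E := by
  obtain ⟨p, q, h, h'⟩ := exists_interval_right hu.reflect hw.reflect
    (fun h => hfar h.of_reflect) (reflect_step hE) (i := m + 1 - i) (by simpa using hi) (by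
      have h₁ : (m - (m + 1 - i - 1) : ℤ) = i := by ring
      simpa [reflectHeight, occ_reflect, h₁] using huw)
  refine ⟨_, _, h.of_reflect, fun c h₁ h₂ => ?_⟩
  simpa using h' (m + 1 - c) (by omega) (by omega)

end Walk

section Multiplication

variable {m k : ℕ} {u v w : ℤ → ℤ} {S : Set ℤ}

/-- The strands on which the middle height function `v` lies outside the range spanned by `u`
and `w`. -/
def detour (u v w : ℤ → ℤ) : Set ℤ :=
  {c | max (u c) (w c) < v c ∨ v c < min (u c) (w c)}

lemma vanishes_of_lt_succ (hu : IsHeight m k u) (hv : IsHeight m k v) (hw : IsHeight m k w)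
    {c : ℤ} (hc : u c < v (c + 1)) : Vanishes u w (detour u v w) := by
  by_cases h : Occ u c
  · have h₁ := hv.le_succ (c + 1)
    have h₂ := hu.nonneg (c + 1)
    unfold Occ at h
    exact vanishes_of_lt_succ hu hv hw (c := c + 1) (by omega)
  · by_cases hfar : FarHeights u w
    · exact Or.inl hfar
    · have hf : ¬(u c < w (c + 1) ∨ w c < u (c + 1)) := fun hf => hfar ⟨c, hf⟩
      have h₁ := hu.succ_le c
      obtain ⟨p, q, hpq, hE⟩ := exists_interval_right hu hw hfar
        (E := {c | max (u c) (w c) < v c}) (i := c + 1)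
        (fun i hi hi' => by have := hv.le_succ i; simp only [Set.mem_ofPred_eq] at *; omega)
        (by simp only [Set.mem_ofPred_eq]; omega) (by simp [h])
      exact Or.inr ⟨p, q, hpq, fun c h₁ h₂ => Or.inl (hE c h₁ h₂)⟩
termination_by (u c).toNat
decreasing_by unfold Occ at h; omega

lemma Vanishes.of_reflect
    (h : Vanishes (reflectHeight m k u) (reflectHeight m k w) {c | (m : ℤ) + 1 - c ∈ S}) :
    Vanishes u w S := by
  refine h.imp FarHeights.of_reflect fun ⟨p, q, h, h'⟩ =>
    ⟨_, _, h.of_reflect, fun c h₁ h₂ => ?_⟩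
  simpa using h' (m + 1 - c) (by omega) (by omega)

lemma vanishes_of_far (hu : IsHeight m k u) (hv : IsHeight m k v) (hw : IsHeight m k w)
    (h : FarHeights u v) : Vanishes u w (detour u v w) := by
  obtain ⟨c, hc | hc⟩ := h
  · exact vanishes_of_lt_succ hu hv hw hc
  · refine Vanishes.of_reflect ((vanishes_of_lt_succ hu.reflect hv.reflect hw.reflect
      (c := m - c) ?_).mono fun a ha => ?_)
    · have h₁ : (m + 1 - (m - c) : ℤ) = c + 1 := by ring
      have h₂ : (m + 1 - (m - c + 1) : ℤ) = c := by ring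
      simp only [reflectHeight, h₁, h₂]
      omega
    · simp only [detour, reflectHeight, Set.mem_ofPred_eq] at *
      omega

lemma Vanishes.mul_right (hu : IsHeight m k u) (hv : IsHeight m k v) (hw : IsHeight m k w)
    (h : Vanishes u v S) : Vanishes u w (S ∪ detour u v w) := by
  by_cases hfar : FarHeights u w
  · exact Or.inl hfar
  obtain h | ⟨p, q, hpq, hS⟩ := h
  · exact (vanishes_of_far hu hv hw h).mono Set.subset_union_right
  have hlt := hpq.lt
  have hEr : ∀ i ∈ {c | max (u c) (w c) < v c ∨ (p < c ∧ c ≤ q) ∧ w c ≤ u c},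
      max (u (i + 1)) (w (i + 1)) < max (u i) (w i) →
      i + 1 ∈ {c | max (u c) (w c) < v c ∨ (p < c ∧ c ≤ q) ∧ w c ≤ u c} := by
    intro i hi hi'
    have h₁ := hu.le_succ i
    have h₂ := hv.le_succ i
    simp only [Set.mem_ofPred_eq] at *
    rcases hi with hi | ⟨⟨hpi, hiq⟩, hi⟩
    · omega
    · have h₃ := hpq.eq i hpi hiq
      rcases hiq.eq_or_lt with rfl | hiq
      · have h₄ := hpq.right
        unfold Occ at h₄
        omega
      · omega
  have hEl : ∀ i ∈ {c | v c < min (u c) (w c) ∨ (p < c ∧ c ≤ q) ∧ u c ≤ w c},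
      min (u i) (w i) < min (u (i - 1)) (w (i - 1)) →
      i - 1 ∈ {c | v c < min (u c) (w c) ∨ (p < c ∧ c ≤ q) ∧ u c ≤ w c} := by
    intro i hi hi'
    have h₁ := hu.pred i
    have h₂ := hv.pred i
    simp only [Set.mem_ofPred_eq] at *
    rcases hi with hi | ⟨⟨hpi, hiq⟩, hi⟩
    · omega
    · have h₃ := hpq.eq i hpi hiq
      by_cases hp : i - 1 = p
      · have h₄ := hpq.left
        simp only [← hp, Occ, sub_add_cancel] at h₄
        omega
      · omega
  by_cases heq : ∀ c, p < c → c ≤ q → u c = w c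
  · have h₁ := heq (p + 1) (by omega) (by omega)
    obtain ⟨q', hq, hq₁, hq₂, hq₃⟩ := exists_right_end hu hw hEr (i := p + 1)
      (by simp only [Set.mem_ofPred_eq]; omega) h₁
    obtain ⟨p', hp, hp₁, hp₂, hp₃⟩ := exists_left_end hu hw hEl (i := p + 1)
      (by simp only [Set.mem_ofPred_eq]; omega) h₁
    refine Or.inr ⟨p', q', ⟨by omega, hp₁, hq₁, fun a ha ha' => ?_, fun c hc hc' => ?_⟩,
      fun c hc hc' => ?_⟩
    · rcases lt_or_ge a (p + 1) with h | h
      · exact hp₂ a ha h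
      · exact hq₂ a h ha'
    · rcases lt_or_ge c (p + 1) with h | h
      · exact (hp₃ c hc h.le).1
      · exact (hq₃ c h hc').1
    · rcases lt_or_ge c (p + 1) with h | h
      · exact (hp₃ c hc h.le).2.elim (fun h => Or.inr (Or.inr h)) fun h => Or.inl (hS c h.1.1 h.1.2)
      · exact (hq₃ c h hc').2.elim (fun h => Or.inr (Or.inl h)) fun h => Or.inl (hS c h.1.1 h.1.2)
  · push Not at heq
    obtain ⟨i, hi, hi', hne⟩ := heq
    right
    rcases hne.lt_or_gt with h | h
    · obtain ⟨p', q', h', hE⟩ := exists_interval_left hu hw hfar hEl (i := i)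
        (Or.inr ⟨⟨hi, hi'⟩, h.le⟩) (Or.inl hne)
      exact ⟨p', q', h', fun c h₁ h₂ => (hE c h₁ h₂).elim (fun h => Or.inr (Or.inr h))
        fun h => Or.inl (hS c h.1.1 h.1.2)⟩
    · obtain ⟨p', q', h', hE⟩ := exists_interval_right hu hw hfar hEr (i := i)
        (Or.inr ⟨⟨hi, hi'⟩, h.le⟩) (Or.inl hne)
      exact ⟨p', q', h', fun c h₁ h₂ => (hE c h₁ h₂).elim (fun h => Or.inr (Or.inl h))
        fun h => Or.inl (hS c h.1.1 h.1.2)⟩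

/-- Passing from the variable of the strand `i` to a shift across the strand `i`. -/
lemma Vanishes.shift (hu : IsHeight m k u) (hv : IsHeight m k v) (hw : IsHeight m k w) {i : ℤ}
    (hne : ∀ a, a ≠ i → w a = v a) (hi : w i = v i + 1 ∨ w i = v i - 1) (huv : u i = v i)
    (h : Vanishes u v (insert i S)) : Vanishes u v S ∨ Vanishes u w S := by
  obtain h | ⟨p, q, hpq, hS⟩ := h
  · exact Or.inl (Or.inl h)
  by_cases hin : p < i ∧ i ≤ q
  swap
  · exact Or.inl (Or.inr ⟨p, q, hpq, fun c h₁ h₂ =>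
      (hS c h₁ h₂).resolve_left (by rintro rfl; exact hin ⟨h₁, h₂⟩)⟩)
  right
  obtain ⟨hpi, hiq⟩ := hin
  have hw₁ := hw.succ_le i
  have hw₂ := hw.le_succ i
  have hw₃ := hw.pred i
  have hv₁ := hv.succ_le i
  have hv₂ := hv.le_succ i
  have hv₃ := hv.pred i
  have hu₁ := hu.succ_le i
  have hu₂ := hu.le_succ i
  have hu₃ := hu.pred i
  have e₁ := hne (i + 1) (by omega)
  have e₂ := hne (i - 1) (by omega)
  have hocc : ∀ a, a ≠ i → a ≠ i - 1 → (Occ w a ↔ Occ v a) := fun a h₁ h₂ => by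
    rw [Occ, Occ, hne a h₁, hne (a + 1) (by omega)]
  rcases hi with hi | hi
  · obtain rfl : i = q := by
      by_contra h
      have := (hpq.inner i hpi (by omega)).2
      unfold Occ at this
      omega
    by_cases hp : p = i - 1
    · have := hpq.left
      simp only [hp, Occ, sub_add_cancel] at this
      exact Or.inl ⟨i - 1, Or.inl (by rw [sub_add_cancel]; omega)⟩
    · refine Or.inr ⟨p, i - 1, ⟨by omega, ?_, ?_, fun a h₁ h₂ => ?_, fun c h₁ h₂ => ?_⟩,
        fun c h₁ h₂ => (hS c h₁ (by omega)).resolve_left (by omega)⟩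
      · rw [hocc p (by omega) hp]
        exact hpq.left
      · simp only [Occ, sub_add_cancel]
        omega
      · rw [hocc a (by omega) (by omega)]
        exact hpq.inner a h₁ (by omega)
      · rw [hne c (by omega)]
        exact hpq.eq c h₁ (by omega)
  · obtain rfl : i - 1 = p := by
      by_contra h
      have := (hpq.inner (i - 1) (by omega) (by omega)).2
      simp only [Occ, sub_add_cancel] at this
      omega
    by_cases hq : q = i
    · have := hpq.right
      simp only [hq, Occ] at this
      exact Or.inl ⟨i, Or.inr (by omega)⟩
    · refine Or.inr ⟨i, q, ⟨by omega, ?_, ?_, fun a h₁ h₂ => ?_, fun c h₁ h₂ => ?_⟩,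
        fun c h₁ h₂ => (hS c (by omega) h₂).resolve_left (by omega)⟩
      · simp only [Occ]
        omega
      · rw [hocc q hq (by omega)]
        exact hpq.right
      · rw [hocc a (by omega) (by omega)]
        exact hpq.inner a (by omega) h₂
      · rw [hne c (by omega)]
        exact hpq.eq c (by omega) h₂

end Multiplication

section States

variable {m k : ℕ}

/-- The number of elements of `x` at or after the position `a`: the height of the strand `a`. -/
def height (x : Finset (Fin (m + 1))) (a : ℤ) : ℤ :=
  (x.filter (fun b => a ≤ (b.val : ℤ))).card

lemma height_of_lt (x : Finset (Fin (m + 1))) {a : ℤ} (ha : (m : ℤ) < a) : height x a = 0 := by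
  simp only [height, Nat.cast_eq_zero, Finset.card_eq_zero, Finset.filter_eq_empty_iff]
  intro b _
  omega

open Classical in
lemma height_eq_succ (x : Finset (Fin (m + 1))) (a : ℤ) :
    height x a = height x (a + 1) + if ∃ b ∈ x, (b.val : ℤ) = a then 1 else 0 := by
  split_ifs with h
  · obtain ⟨b, hb, rfl⟩ := h
    have : x.filter (fun c => (b.val : ℤ) ≤ c.val) =
        insert b (x.filter (fun c => (b.val : ℤ) + 1 ≤ c.val)) := by
      ext c
      simp only [Finset.mem_filter, Finset.mem_insert, Fin.ext_iff]
      constructor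
      · rintro ⟨h₁, h₂⟩
        by_cases h : c.val = b.val
        · exact Or.inl h
        · exact Or.inr ⟨h₁, by omega⟩
      · rintro (h | ⟨h₁, h₂⟩)
        · obtain rfl := Fin.ext h
          exact ⟨hb, le_rfl⟩
        · exact ⟨h₁, by omega⟩
    rw [height, height, this, Finset.card_insert_of_notMem (by simp)]
    push_cast
    rfl
  · rw [height, height, add_zero]
    congr 2
    refine Finset.filter_congr fun c hc => ⟨fun h₁ => ?_, fun h₁ => by omega⟩
    have : (c.val : ℤ) ≠ a := fun h' => h ⟨c, hc, h'⟩
    omega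

open Classical in
lemma height_eq_of_step (x : Finset (Fin (m + 1))) {u : ℤ → ℤ} (hu : ∀ a, (m : ℤ) < a → u a = 0)
    (hs : ∀ a, u a = u (a + 1) + if ∃ b ∈ x, (b.val : ℤ) = a then 1 else 0) : height x = u := by
  funext a
  rcases lt_or_ge (m : ℤ) a with h | h
  · rw [height_of_lt x h, hu a h]
  · induction a, h using Int.leInductionDown with
    | base =>
      rw [height_eq_succ, hs, height_of_lt x (by omega), hu _ (by omega)]
    | pred n hn ih => rw [height_eq_succ, hs, sub_add_cancel, ih]

lemma isHeight_height (x : IdemState m k) : IsHeight m k (height x.1) where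
  succ_le a := by
    rw [height_eq_succ x.1 a]
    split_ifs <;> omega
  le_succ a := by
    rw [height_eq_succ x.1 a]
    split_ifs <;> omega
  left a ha := by
    rw [height, Finset.filter_true_of_mem (fun b _ => by omega), x.2]
  right a ha := height_of_lt x.1 ha

lemma occ_height {x : Finset (Fin (m + 1))} {b : Fin (m + 1)} :
    Occ (height x) b.val ↔ b ∈ x := by
  rw [Occ, height_eq_succ x b.val]
  have : (∃ c ∈ x, (c.val : ℤ) = b.val) ↔ b ∈ x :=
    ⟨fun ⟨c, hc, h⟩ => (Fin.ext (by omega) : c = b) ▸ hc, fun h => ⟨b, h, rfl⟩⟩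
  simp only [this]
  split_ifs <;> simpa

lemma height_injective {x y : IdemState m k} (h : height x.1 = height y.1) : x = y := by
  ext b
  rw [← occ_height, h, occ_height]

lemma exists_height_eq {u : ℤ → ℤ} (hu : IsHeight m k u) :
    ∃ z : IdemState m k, height z.1 = u := by
  have h : height (Finset.univ.filter fun b : Fin (m + 1) => u (b.val + 1) < u b.val) = u := by
    classical
    refine height_eq_of_step _ hu.right fun a => ?_
    have h₁ := hu.succ_le a
    have h₂ := hu.le_succ a
    split_ifs with h
    · obtain ⟨b, hb, rfl⟩ := h
      have := (Finset.mem_filter.1 hb).2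
      omega
    · by_contra hne
      rcases lt_or_ge a 0 with ha | ha
      · rw [hu.left a ha.le, hu.left (a + 1) (by omega)] at hne
        omega
      rcases lt_or_ge (m : ℤ) a with ha' | ha'
      · rw [hu.right a ha', hu.right (a + 1) (by omega)] at hne
        omega
      · refine h ⟨⟨a.toNat, by omega⟩, ?_, by simpa⟩
        simp only [Finset.mem_filter, Finset.mem_univ, true_and, Int.toNat_of_nonneg ha]
        omega
  refine ⟨⟨_, ?_⟩, h⟩
  have h₀ := congrFun h 0
  rw [hu.left 0 le_rfl, height, Finset.filter_true_of_mem (fun b _ => by omega)] at h₀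
  exact_mod_cast h₀

/-- Moving an element of `x` across the strand `i + 1` gives `y`: to the right for `ε = 1` and to
the left for `ε = -1`. -/
def IsShift (ε : ℤ) (i : Fin m) (x y : IdemState m k) : Prop :=
  ∀ a, height y.1 a = height x.1 a + if a = i.val + 1 then ε else 0

lemma IsShift.symm {ε : ℤ} {i : Fin m} {x y : IdemState m k} (h : IsShift ε i x y) :
    IsShift (-ε) i y x := fun a => by
  rw [h a]
  split_ifs <;> omega

lemma IsShift.unique {ε : ℤ} {i : Fin m} {x y z : IdemState m k} (hy : IsShift ε i x y)
    (hz : IsShift ε i x z) : y = z :=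
  height_injective (funext fun a => by rw [hy a, hz a])

lemma IsShift.unique_left {ε : ℤ} {i : Fin m} {x y z : IdemState m k} (hx : IsShift ε i x z)
    (hy : IsShift ε i y z) : x = y := hx.symm.unique hy.symm

lemma isShift_one_iff {i : Fin m} {x y : IdemState m k} :
    IsShift 1 i x y ↔ i.castSucc ∈ x.1 ∧ i.succ ∉ x.1 ∧
      y.1 = insert i.succ (x.1.erase i.castSucc) := by
  constructor
  · intro h
    have e₀ := h i.val
    have e₁ := h (i.val + 1)
    have e₂ := h (i.val + 1 + 1)
    have hx := isHeight_height x
    have hy := isHeight_height y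
    have a₁ := hx.succ_le i.val
    have a₂ := hy.le_succ i.val
    have a₃ := hx.succ_le (i.val + 1)
    have a₄ := hy.le_succ (i.val + 1)
    have b₁ := hx.le_succ i.val
    have b₂ := hy.succ_le i.val
    have b₃ := hx.le_succ (i.val + 1)
    have b₄ := hy.succ_le (i.val + 1)
    simp at e₀ e₁ e₂
    have hc : (i.castSucc.val : ℤ) = i.val := rfl
    have hs : (i.succ.val : ℤ) = i.val + 1 := by simp
    refine ⟨?_, ?_, ?_⟩
    · rw [← occ_height, Occ, hc]
      omega
    · rw [← occ_height, Occ, hs]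
      omega
    · ext b
      rw [Finset.mem_insert, Finset.mem_erase]
      by_cases h₁ : b = i.succ
      · subst h₁
        rw [← occ_height, ← occ_height, Occ, hs]
        simp only [true_or, iff_true]
        omega
      by_cases h₂ : b = i.castSucc
      · subst h₂
        rw [← occ_height, ← occ_height, Occ, hc]
        simp [h₁]
        omega
      · have h₃ : (b.val : ℤ) ≠ i.val + 1 := fun h => h₁ (Fin.ext (by simp; omega))
        have h₄ : (b.val : ℤ) ≠ i.val := fun h => h₂ (Fin.ext (by simp; omega))
        rw [← occ_height, ← occ_height, Occ, Occ, h b.val, h (b.val + 1)]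
        simp [h₁, h₂, h₃, h₄]
  · classical
    rintro ⟨h₁, h₂, h₃⟩
    refine fun a => congrFun (height_eq_of_step y.1
      (u := fun a => height x.1 a + if a = i.val + 1 then 1 else 0) (fun a ha => ?_)
      (fun a => ?_)) a
    · rw [height_of_lt _ ha, if_neg (by omega), add_zero]
    · have hy : (∃ b ∈ y.1, (b.val : ℤ) = a) ↔
          a = i.val + 1 ∨ (a ≠ i.val ∧ ∃ b ∈ x.1, (b.val : ℤ) = a) := by
        rw [h₃]
        constructor
        · rintro ⟨b, hb, rfl⟩
          rcases Finset.mem_insert.1 hb with rfl | hb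
          · exact Or.inl (by simp)
          · obtain ⟨hb₁, hb₂⟩ := Finset.mem_erase.1 hb
            exact Or.inr ⟨fun h => hb₁ (Fin.ext (by simp; omega)), b, hb₂, rfl⟩
        · rintro (rfl | ⟨h, b, hb, rfl⟩)
          · exact ⟨i.succ, Finset.mem_insert_self _ _, by simp⟩
          · exact ⟨b, Finset.mem_insert_of_mem (Finset.mem_erase.2
              ⟨by rintro rfl; exact h rfl, hb⟩), rfl⟩
      have hx₁ : ∃ b ∈ x.1, (b.val : ℤ) = i.val := ⟨_, h₁, rfl⟩
      have hx₂ : ¬∃ b ∈ x.1, (b.val : ℤ) = i.val + 1 := by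
        rintro ⟨b, hb, hb'⟩
        exact h₂ ((Fin.ext (by simp; omega) : b = i.succ) ▸ hb)
      simp only [hy]
      rw [height_eq_succ x.1 a]
      by_cases c₁ : a = i.val + 1
      · subst c₁
        simp [hx₂]
      by_cases c₂ : a = i.val
      · subst c₂
        rw [if_pos hx₁]
        simp
      · have c₃ : a + 1 ≠ i.val + 1 := by omega
        simp [c₁, c₂]

lemma isShift_neg_one_iff {i : Fin m} {x y : IdemState m k} :
    IsShift (-1) i x y ↔ i.succ ∈ x.1 ∧ i.castSucc ∉ x.1 ∧
      y.1 = insert i.castSucc (x.1.erase i.succ) := by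
  have hne : i.castSucc ≠ i.succ := Fin.castSucc_lt_succ.ne
  have h : IsShift (-1) i x y ↔ IsShift 1 i y x :=
    ⟨fun h => by simpa using h.symm, fun h => h.symm⟩
  rw [h, isShift_one_iff]
  constructor
  · rintro ⟨h₁, h₂, h₃⟩
    rw [h₃]
    refine ⟨by simp, by simp [hne], ?_⟩
    rw [Finset.erase_insert (by simp [h₂]), Finset.insert_erase h₁]
  · rintro ⟨h₁, h₂, h₃⟩
    rw [h₃]
    refine ⟨by simp, by simp [hne.symm], ?_⟩
    rw [Finset.erase_insert (by simp [h₂]), Finset.insert_erase h₁]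

lemma coe_vwt (x : Finset (Fin (m + 1))) (c : Fin m) : (vwt x c : ℤ) = height x (c.val + 1) := by
  rw [vwt, height]
  congr 2
  exact Finset.filter_congr fun b _ => by omega

lemma coe_wnum (x y : Finset (Fin (m + 1))) (c : Fin m) :
    (wnum x y c : ℤ) = |height x (c.val + 1) - height y (c.val + 1)| := by
  rw [wnum, coe_vwt, coe_vwt, Int.natCast_natAbs]

/-- The correction exponent is the distance of the middle height from the range spanned by the
outer ones. -/
lemma coe_texp (x y z : IdemState m k) (c : Fin m) :
    (texp x y z c : ℤ) =
      max 0 (max (height y.1 (c.val + 1) - max (height x.1 (c.val + 1)) (height z.1 (c.val + 1)))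
        (min (height x.1 (c.val + 1)) (height z.1 (c.val + 1)) - height y.1 (c.val + 1))) := by
  simp only [texp, wnum, ← coe_vwt]
  omega

lemma texp_comm (x y z : IdemState m k) (c : Fin m) : texp x y z c = texp z y x c := by
  have h₁ := coe_texp x y z c
  have h₂ := coe_texp z y x c
  omega

lemma two_mul_texp (x y z : IdemState m k) (c : Fin m) :
    2 * texp x y z c + wnum x.1 z.1 c = wnum x.1 y.1 c + wnum y.1 z.1 c := by
  simp only [texp, wnum]
  omega

lemma texp_assoc (x y z w : IdemState m k) (c : Fin m) :
    texp x y z c + texp x z w c = texp y z w c + texp x y w c := by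
  have h₁ := two_mul_texp x y z c
  have h₂ := two_mul_texp x z w c
  have h₃ := two_mul_texp y z w c
  have h₄ := two_mul_texp x y w c
  omega

lemma texp_left (x y : IdemState m k) (c : Fin m) : texp x x y c = 0 := by
  have := coe_texp x x y c
  omega

lemma texp_right (x y : IdemState m k) (c : Fin m) : texp x y y c = 0 := by
  rw [texp_comm, texp_left]

/-- The strands whose variable occurs in the monomial with exponents `s`. -/
def strands (s : Fin m → ℕ) : Set ℤ := {a | ∃ c : Fin m, a = c.val + 1 ∧ 1 ≤ s c}

lemma strands_mono {s t : Fin m → ℕ} (h : s ≤ t) : strands s ⊆ strands t :=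
  fun _ ⟨c, hc, hc'⟩ => ⟨c, hc, hc'.trans (h c)⟩

lemma detour_subset_strands (x y z : IdemState m k) :
    detour (height x.1) (height y.1) (height z.1) ⊆ strands (texp x y z) := by
  intro a ha
  simp only [detour, Set.mem_ofPred_eq] at ha
  have h₁ : 0 < a := by
    by_contra h
    rw [(isHeight_height x).left a (by omega), (isHeight_height y).left a (by omega),
      (isHeight_height z).left a (by omega)] at ha
    omega
  have h₂ : a ≤ m := by
    by_contra h
    rw [height_of_lt x.1 (by omega), height_of_lt y.1 (by omega),
      height_of_lt z.1 (by omega)] at ha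
    omega
  have h₃ : a = (a - 1).toNat + 1 := by omega
  refine ⟨⟨(a - 1).toNat, by omega⟩, h₃, ?_⟩
  have := coe_texp x y z ⟨(a - 1).toNat, by omega⟩
  simp only [← h₃] at this
  omega

/-- The combinatorial criterion for a basis element to vanish in the quotient. -/
def BGen.Zero (g : BGen m k) : Prop := Vanishes (height g.l.1) (height g.r.1) (strands g.s)

lemma BGen.Zero.mul_right {x y z : IdemState m k} {s t : Fin m → ℕ}
    (h : BGen.Zero ⟨x, y, s⟩) : BGen.Zero ⟨x, z, fun c => s c + t c + texp x y z c⟩ := by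
  refine (Vanishes.mul_right (isHeight_height x) (isHeight_height y) (isHeight_height z) h).mono
    (Set.union_subset (strands_mono fun c => ?_) ((detour_subset_strands x y z).trans
      (strands_mono fun c => ?_))) <;> dsimp only <;> omega

lemma BGen.Zero.mul_left {x y z : IdemState m k} {s t : Fin m → ℕ}
    (h : BGen.Zero ⟨y, z, s⟩) : BGen.Zero ⟨x, z, fun c => t c + s c + texp x y z c⟩ := by
  have h' : BGen.Zero ⟨z, y, s⟩ := Vanishes.symm h
  have := Vanishes.symm (h'.mul_right (z := x) (t := t))
  simp only [add_comm (s _), texp_comm z y x] at this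
  exact this

end States

section Algebra

variable {m k : ℕ}

/-- The contribution of a pair of basis elements to a product, as a function of the coefficient. -/
noncomputable def mulTerm (a b : BGen m k) : ZMod 2 →+ (BGen m k →₀ ZMod 2) :=
  match mulBGen a b with
  | some c => Finsupp.singleAddHom c
  | none => 0

lemma mulB_eq (f g : B0 m k) : mulB f g =
    (B0.toF f).sum fun a c => (B0.toF g).sum fun b d => mulTerm a b (c * d) := by
  refine Finset.sum_congr rfl fun a _ => Finset.sum_congr rfl fun b _ => ?_
  dsimp only
  unfold mulTerm
  cases mulBGen a b <;> rfl

lemma mulB_add_left (f g h : B0 m k) : mulB (f + g) h = mulB f h + mulB g h := by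
  simp only [mulB_eq]
  refine Finsupp.sum_add_index' (fun a => ?_) (fun a c d => ?_)
  · simp
    rfl
  · simp only [add_mul, map_add]
    exact Finsupp.sum_add

lemma mulB_add_right (f g h : B0 m k) : mulB f (g + h) = mulB f g + mulB f h := by
  simp only [mulB_eq]
  refine Eq.trans (Finset.sum_congr rfl fun a _ => ?_) Finset.sum_add_distrib
  refine Finsupp.sum_add_index' (fun b => ?_) (fun b c d => ?_)
  · simp
    rfl
  · simp only [mul_add, map_add]
    rfl

lemma bElt_mul_bElt (a b : BGen m k) :
    bElt a * bElt b = match mulBGen a b with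
      | some c => bElt c
      | none => 0 := by
  refine (mulB_eq _ _).trans ((Finsupp.sum_single_index (by simp; rfl)).trans
    ((Finsupp.sum_single_index (by simp; rfl)).trans ?_))
  rw [mul_one]
  unfold mulTerm
  cases mulBGen a b <;> rfl

lemma B0.induction {P : B0 m k → Prop} (zero : P 0) (add : ∀ f g, P f → P g → P (f + g))
    (basis : ∀ a, P (bElt a)) (f : B0 m k) : P f := by
  refine Finsupp.induction_linear f zero add fun a c => ?_
  obtain rfl | rfl : c = 0 ∨ c = 1 := by revert c; decide
  · rw [Finsupp.single_zero]
    exact zero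
  · exact basis a

lemma mulB_zero_left (f : B0 m k) : mulB 0 f = 0 := by
  simpa using mulB_add_left 0 0 f

lemma mulB_zero_right (f : B0 m k) : mulB f 0 = 0 := by
  simpa using mulB_add_right f 0 0

lemma bElt_mul_bElt_mk (x y z : IdemState m k) (s t : Fin m → ℕ) :
    bElt ⟨x, y, s⟩ * bElt ⟨y, z, t⟩ = bElt ⟨x, z, fun c => s c + t c + texp x y z c⟩ := by
  rw [bElt_mul_bElt, mulBGen, if_pos rfl]

lemma bElt_mul_bElt_of_ne {a b : BGen m k} (h : a.r ≠ b.l) : bElt a * bElt b = 0 := by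
  rw [bElt_mul_bElt, mulBGen, if_neg h]

lemma bElt_mul_assoc (a b c : BGen m k) :
    mulB (mulB (bElt a) (bElt b)) (bElt c) = mulB (bElt a) (mulB (bElt b) (bElt c)) := by
  change bElt a * bElt b * bElt c = bElt a * (bElt b * bElt c)
  obtain ⟨x, y, s⟩ := a
  obtain ⟨y', z, t⟩ := b
  obtain ⟨z', w, r⟩ := c
  by_cases hy : y = y'
  · subst hy
    by_cases hz : z = z'
    · subst hz
      simp only [bElt_mul_bElt_mk]
      congr 2
      funext c
      have := texp_assoc x y z w c
      omega
    · rw [bElt_mul_bElt_of_ne (a := ⟨y, z, t⟩) (b := ⟨z', w, r⟩) hz, bElt_mul_bElt_mk,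
        bElt_mul_bElt_of_ne hz]
      exact (mulB_zero_right _).symm
  · rw [bElt_mul_bElt_of_ne (a := ⟨x, y, s⟩) (b := ⟨y', z, t⟩) hy]
    refine (mulB_zero_left _).trans ?_
    by_cases hz : z = z'
    · subst hz
      rw [bElt_mul_bElt_mk, bElt_mul_bElt_of_ne hy]
    · rw [bElt_mul_bElt_of_ne (a := ⟨y', z, t⟩) (b := ⟨z', w, r⟩) hz]
      exact (mulB_zero_right _).symm

noncomputable instance : NonUnitalRing (B0 m k) where
  __ := (inferInstance : AddCommGroup (B0 m k))
  __ := (inferInstance : Mul (B0 m k))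
  left_distrib := mulB_add_right
  right_distrib := mulB_add_left
  zero_mul := mulB_zero_left
  mul_zero := mulB_zero_right
  mul_assoc f g h := by
    change mulB (mulB f g) h = mulB f (mulB g h)
    induction f using B0.induction with
    | zero => simp only [mulB_zero_left]
    | add f f' hf hf' => simp only [mulB_add_left, hf, hf']
    | basis a =>
      induction g using B0.induction with
      | zero => simp only [mulB_zero_left, mulB_zero_right]
      | add g g' hg hg' => simp only [mulB_add_left, mulB_add_right, hg, hg']
      | basis b =>
        induction h using B0.induction with
        | zero => simp only [mulB_zero_right]
        | add h h' hh hh' => simp only [mulB_add_right, hh, hh']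
        | basis c => exact bElt_mul_assoc a b c

open Classical in
/-- The sum of all basis elements moving one element across the strand `i + 1` in the direction
given by the sign `ε`. -/
noncomputable def shiftElt (ε : ℤ) (i : Fin m) : B0 m k :=
  ∑ p : IdemState m k × IdemState m k,
    if IsShift ε i p.1 p.2 then bElt ⟨p.1, p.2, fun _ => 0⟩ else 0

lemma RElt_eq (i : Fin m) : (RElt i : B0 m k) = shiftElt 1 i := by
  classical
  exact Finset.sum_congr rfl fun _ _ => if_congr isShift_one_iff.symm rfl rfl

lemma LElt_eq (i : Fin m) : (LElt i : B0 m k) = shiftElt (-1) i := by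
  classical
  exact Finset.sum_congr rfl fun _ _ => if_congr isShift_neg_one_iff.symm rfl rfl

variable {ε : ℤ} {i : Fin m} {x y z : IdemState m k} {s : Fin m → ℕ}

lemma bElt_mul_shiftElt (h : IsShift ε i y z) :
    bElt ⟨x, y, s⟩ * shiftElt ε i = bElt ⟨x, z, fun c => s c + texp x y z c⟩ := by
  rw [shiftElt, Finset.mul_sum, Finset.sum_eq_single (y, z)]
  · rw [if_pos h, bElt_mul_bElt_mk]
    rfl
  · rintro ⟨y', z'⟩ - hne
    split_ifs with h'
    · refine bElt_mul_bElt_of_ne fun hy => ?_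
      obtain rfl : y = y' := hy
      exact hne (by rw [h.unique h'])
    · exact mul_zero _
  · simp

lemma bElt_mul_shiftElt_eq_zero (h : ∀ z, ¬IsShift ε i y z) :
    bElt ⟨x, y, s⟩ * shiftElt ε i = 0 := by
  rw [shiftElt, Finset.mul_sum]
  refine Finset.sum_eq_zero fun p _ => ?_
  split_ifs with h'
  · refine bElt_mul_bElt_of_ne fun hy => ?_
    obtain rfl : y = p.1 := hy
    exact h _ h'
  · exact mul_zero _

lemma shiftElt_mul_bElt (h : IsShift ε i x y) :
    shiftElt ε i * bElt ⟨y, z, s⟩ = bElt ⟨x, z, fun c => s c + texp x y z c⟩ := by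
  rw [shiftElt, Finset.sum_mul, Finset.sum_eq_single (x, y)]
  · rw [if_pos h, bElt_mul_bElt_mk]
    simp only [zero_add]
  · rintro ⟨x', y'⟩ - hne
    split_ifs with h'
    · refine bElt_mul_bElt_of_ne fun hy => ?_
      obtain rfl : y' = y := hy
      exact hne (by rw [h.unique_left h'])
    · exact zero_mul _
  · simp

lemma shiftElt_mul_bElt_eq_zero (h : ∀ x, ¬IsShift ε i x y) :
    shiftElt ε i * bElt ⟨y, z, s⟩ = 0 := by
  rw [shiftElt, Finset.sum_mul]
  refine Finset.sum_eq_zero fun p _ => ?_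
  split_ifs with h'
  · refine bElt_mul_bElt_of_ne fun hy => ?_
    obtain rfl : p.2 = y := hy
    exact h _ h'
  · exact zero_mul _

lemma bElt_mul_UElt : bElt ⟨x, y, s⟩ * UElt i =
    bElt ⟨x, y, fun c => s c + if c = i then 1 else 0⟩ := by
  rw [UElt, Finset.mul_sum, Finset.sum_eq_single y]
  · rw [bElt_mul_bElt_mk]
    simp only [texp_right, add_zero]
  · exact fun y' _ hne => bElt_mul_bElt_of_ne fun hy => hne hy.symm
  · simp

lemma UElt_mul_bElt : UElt i * bElt ⟨x, y, s⟩ =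
    bElt ⟨x, y, fun c => s c + if c = i then 1 else 0⟩ := by
  rw [UElt, Finset.sum_mul, Finset.sum_eq_single x]
  · rw [bElt_mul_bElt_mk]
    simp only [texp_left, add_zero]
    congr 2
    funext c
    exact add_comm _ _
  · exact fun x' _ hne => bElt_mul_bElt_of_ne hne
  · simp

end Algebra

section Ideal

variable {m k : ℕ}

/-- The span of the basis elements that satisfy the vanishing criterion. -/
noncomputable def zeroSpan (m k : ℕ) : AddSubgroup (B0 m k) :=
  AddSubgroup.closure {f | ∃ a : BGen m k, a.Zero ∧ f = bElt a}

lemma bElt_mem_zeroSpan {a : BGen m k} (h : a.Zero) : bElt a ∈ zeroSpan m k :=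
  AddSubgroup.subset_closure ⟨a, h, rfl⟩

lemma zero_of_bElt_mem_zeroSpan {a : BGen m k} (h : bElt a ∈ zeroSpan m k) : a.Zero := by
  have key : ∀ f ∈ zeroSpan m k, ∀ b, B0.toF f b ≠ 0 → b.Zero := by
    intro f hf
    induction hf using AddSubgroup.closure_induction with
    | mem f hf =>
      obtain ⟨c, hc, rfl⟩ := hf
      intro b hb
      obtain ⟨rfl, -⟩ := Finsupp.single_apply_ne_zero.1 hb
      exact hc
    | zero => exact fun b hb => (hb rfl).elim
    | add f g _ _ hf hg =>
      intro b hb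
      by_cases h : B0.toF f b = 0
      · refine hg b fun h' => hb ?_
        change B0.toF f b + B0.toF g b = 0
        rw [h, h', add_zero]
      · exact hf b h
    | neg f _ hf => exact fun b hb => hf b fun h => hb (neg_eq_zero.2 h)
  refine key _ h a ?_
  simp [bElt, B0.toF]

lemma mul_mem_zeroSpan_right {f : B0 m k} (hf : f ∈ zeroSpan m k) (g : B0 m k) :
    f * g ∈ zeroSpan m k := by
  induction g using B0.induction with
  | zero => rw [mul_zero]; exact zero_mem _
  | add g g' hg hg' => rw [mul_add]; exact add_mem hg hg'
  | basis b =>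
    induction hf using AddSubgroup.closure_induction with
    | mem f hf =>
      obtain ⟨⟨x, y, s⟩, ha, rfl⟩ := hf
      obtain ⟨y', z, t⟩ := b
      by_cases h : y = y'
      · subst h
        rw [bElt_mul_bElt_mk]
        exact bElt_mem_zeroSpan ha.mul_right
      · rw [bElt_mul_bElt_of_ne h]
        exact zero_mem _
    | zero => rw [zero_mul]; exact zero_mem _
    | add f f' _ _ hf hf' => rw [add_mul]; exact add_mem hf hf'
    | neg f _ hf => rw [neg_mul]; exact neg_mem hf

lemma mul_mem_zeroSpan_left {f : B0 m k} (hf : f ∈ zeroSpan m k) (g : B0 m k) :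
    g * f ∈ zeroSpan m k := by
  induction g using B0.induction with
  | zero => rw [zero_mul]; exact zero_mem _
  | add g g' hg hg' => rw [add_mul]; exact add_mem hg hg'
  | basis b =>
    induction hf using AddSubgroup.closure_induction with
    | mem f hf =>
      obtain ⟨⟨y', z, s⟩, ha, rfl⟩ := hf
      obtain ⟨x, y, t⟩ := b
      by_cases h : y = y'
      · subst h
        rw [bElt_mul_bElt_mk]
        exact bElt_mem_zeroSpan ha.mul_left
      · rw [bElt_mul_bElt_of_ne h]
        exact zero_mem _
    | zero => rw [mul_zero]; exact zero_mem _
    | add f f' _ _ hf hf' => rw [mul_add]; exact add_mem hf hf'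
    | neg f _ hf => rw [mul_neg]; exact neg_mem hf

lemma shiftElt_mul_shiftElt_mem_zeroSpan {ε : ℤ} {i j : Fin m}
    (h : ∀ x y z : IdemState m k, IsShift ε i x y → IsShift ε j y z →
      FarHeights (height x.1) (height z.1)) :
    (shiftElt ε i * shiftElt ε j : B0 m k) ∈ zeroSpan m k := by
  rw [shiftElt, Finset.sum_mul]
  refine sum_mem fun p _ => ?_
  split_ifs with h₁
  · by_cases h₂ : ∃ z, IsShift ε j p.2 z
    · obtain ⟨z, hz⟩ := h₂
      rw [bElt_mul_shiftElt hz]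
      exact bElt_mem_zeroSpan (Or.inl (h _ _ _ h₁ hz))
    · push Not at h₂
      rw [bElt_mul_shiftElt_eq_zero h₂]
      exact zero_mem _
  · rw [zero_mul]
    exact zero_mem _

lemma JGenerators_subset_zeroSpan : JGenerators m k ⊆ zeroSpan m k := by
  rintro _ (⟨i, i', hi, rfl | rfl⟩ | ⟨j, x, h₁, h₂, rfl⟩)
  · rw [LElt_eq, LElt_eq]
    refine shiftElt_mul_shiftElt_mem_zeroSpan fun x y z hxy hyz => ⟨i.val + 1, Or.inr ?_⟩
    have a₁ := hxy (i.val + 1)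
    have a₂ := hxy (i.val + 1 + 1)
    have a₃ := hyz (i.val + 1)
    have a₄ := (isHeight_height y).le_succ (i.val + 1)
    simp [hi] at a₁ a₂ a₃
    omega
  · rw [RElt_eq, RElt_eq]
    refine shiftElt_mul_shiftElt_mem_zeroSpan fun x y z hxy hyz => ⟨i.val + 1, Or.inl ?_⟩
    have a₁ := hxy (i.val + 1)
    have a₂ := hxy (i.val + 1 + 1)
    have a₃ := hyz (i.val + 1 + 1)
    have a₄ := (isHeight_height y).le_succ (i.val + 1)
    simp [hi] at a₁ a₂ a₃
    omega
  · rw [idemElt, bElt_mul_UElt]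
    refine bElt_mem_zeroSpan (Or.inr ⟨j.val, j.val + 1, ⟨by omega, ?_, ?_, fun a _ _ => by omega,
      fun _ _ _ => rfl⟩, fun c h₁ h₂ => ⟨j, by omega, by simp⟩⟩)
    · exact fun h => h₁ ((occ_height (b := j.castSucc)).1 h.1)
    · refine fun h => h₂ ((occ_height (b := j.succ)).1 ?_)
      rw [Fin.val_succ]
      exact_mod_cast h.1

lemma JIdeal_le_zeroSpan : JIdeal m k ≤ zeroSpan m k := by
  refine (AddSubgroup.closure_le _).2 ?_
  rintro _ ⟨g, hg, a, b, rfl⟩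
  exact mul_mem_zeroSpan_right (mul_mem_zeroSpan_left (JGenerators_subset_zeroSpan hg) a) b

lemma mul_mul_mem_JIdeal {g : B0 m k} (hg : g ∈ JGenerators m k) (a b : B0 m k) :
    a * g * b ∈ JIdeal m k :=
  AddSubgroup.subset_closure ⟨g, hg, a, b, rfl⟩

/-- The height function `f` clamped to the range spanned by `u` and `v`. -/
def clampHeight (u v f : ℤ → ℤ) (a : ℤ) : ℤ :=
  max (min (u a) (v a)) (min (max (u a) (v a)) (f a))

lemma IsHeight.clamp {u v f : ℤ → ℤ} (hu : IsHeight m k u) (hv : IsHeight m k v)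
    (hf : ∀ a, f (a + 1) ≤ f a ∧ f a ≤ f (a + 1) + 1) : IsHeight m k (clampHeight u v f) where
  succ_le a := by
    have h₁ := hu.succ_le a
    have h₂ := hv.succ_le a
    have h₃ := hf a
    simp only [clampHeight]
    omega
  le_succ a := by
    have h₁ := hu.le_succ a
    have h₂ := hv.le_succ a
    have h₃ := hf a
    simp only [clampHeight]
    omega
  left a ha := by
    simp only [clampHeight, hu.left a ha, hv.left a ha]
    omega
  right a ha := by
    simp only [clampHeight, hu.right a ha, hv.right a ha]
    omega

lemma exists_far_path {x y : IdemState m k} {c : ℤ}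
    (hc : height x.1 c < height y.1 (c + 1)) :
    ∃ (i i' : Fin m) (z₀ z₁ z₂ : IdemState m k), (i' : ℕ) = i + 1 ∧
      IsShift 1 i z₀ z₁ ∧ IsShift 1 i' z₁ z₂ ∧
      ∀ a, height x.1 a ≤ height z₀.1 a ∧ height z₀.1 a ≤ height z₁.1 a ∧
          height z₁.1 a ≤ height z₂.1 a ∧ height z₂.1 a ≤ height y.1 a ∨
        height y.1 a ≤ height z₂.1 a ∧ height z₂.1 a ≤ height z₁.1 a ∧
          height z₁.1 a ≤ height z₀.1 a ∧ height z₀.1 a ≤ height x.1 a := by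
  have hx := isHeight_height x
  have hy := isHeight_height y
  have hc₁ : 0 < c := by
    by_contra h
    have h₁ := hx.left c (by omega)
    have h₂ := hy.le_top (c + 1)
    omega
  have hc₂ : c < m := by
    by_contra h
    have h₁ := hy.right (c + 1) (by omega)
    have h₂ := hx.nonneg c
    omega
  have hf : ∀ d a : ℤ, (if a + 1 < d then height x.1 c + 1 else height x.1 c) ≤
        (if a < d then height x.1 c + 1 else height x.1 c) ∧
      (if a < d then height x.1 c + 1 else height x.1 c) ≤
        (if a + 1 < d then height x.1 c + 1 else height x.1 c) + 1 := by
    intro d a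
    split_ifs <;> omega
  obtain ⟨z₀, h₀⟩ := exists_height_eq (hx.clamp hy (hf c))
  obtain ⟨z₁, h₁⟩ := exists_height_eq (hx.clamp hy (hf (c + 1)))
  obtain ⟨z₂, h₂⟩ := exists_height_eq (hx.clamp hy (hf (c + 2)))
  have e₁ := hx.succ_le c
  have e₂ := hy.succ_le c
  refine ⟨⟨(c - 1).toNat, by omega⟩, ⟨c.toNat, by omega⟩, z₀, z₁, z₂, by simp only; omega,
    fun a => ?_, fun a => ?_, fun a => ?_⟩
  · rw [h₀, h₁]
    have h : ((c - 1).toNat : ℤ) + 1 = c := by omega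
    simp only [clampHeight, h]
    by_cases ha : a = c
    · subst ha
      simp
      omega
    · have : a < c ↔ a < c + 1 := by omega
      simp [ha, this]
  · rw [h₁, h₂]
    have h : (c.toNat : ℤ) + 1 = c + 1 := by omega
    simp only [clampHeight, h]
    by_cases ha : a = c + 1
    · subst ha
      simp
      omega
    · have : a < c + 1 ↔ a < c + 2 := by omega
      simp [ha, this]
  · rw [h₀, h₁, h₂]
    simp only [clampHeight]
    rcases lt_trichotomy a c with ha | rfl | ha
    · rw [if_pos ha, if_pos (by omega), if_pos (by omega)]
      omega
    · rw [if_neg (by omega), if_pos (by omega), if_pos (by omega)]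
      omega
    rcases (Int.add_one_le_of_lt ha).eq_or_lt with rfl | ha'
    · rw [if_neg (by omega), if_neg (by omega), if_pos (by omega)]
      omega
    · rw [if_neg (by omega), if_neg (by omega), if_neg (by omega)]
      omega

lemma bElt_mem_JIdeal_of_far {x y : IdemState m k} {s : Fin m → ℕ}
    (h : FarHeights (height x.1) (height y.1)) : bElt ⟨x, y, s⟩ ∈ JIdeal m k := by
  obtain ⟨c, hc | hc⟩ := h
  · obtain ⟨i, i', z₀, z₁, z₂, hi, h₁, h₂, hb⟩ := exists_far_path hc
    have := mul_mul_mem_JIdeal (Or.inl ⟨i, i', hi, Or.inr rfl⟩) (bElt ⟨x, z₀, s⟩)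
      (bElt ⟨z₂, y, fun _ => 0⟩)
    rw [RElt_eq, RElt_eq, ← mul_assoc, bElt_mul_shiftElt h₁, bElt_mul_shiftElt h₂,
      bElt_mul_bElt_mk] at this
    convert this using 3
    funext c
    have e₁ := coe_texp x z₀ z₁ c
    have e₂ := coe_texp x z₁ z₂ c
    have e₃ := coe_texp x z₂ y c
    have := hb (c.val + 1)
    omega
  · obtain ⟨i, i', z₀, z₁, z₂, hi, h₁, h₂, hb⟩ := exists_far_path hc
    have := mul_mul_mem_JIdeal (Or.inl ⟨i, i', hi, Or.inl rfl⟩) (bElt ⟨x, z₂, s⟩)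
      (bElt ⟨z₀, y, fun _ => 0⟩)
    rw [LElt_eq, LElt_eq, ← mul_assoc, bElt_mul_shiftElt h₂.symm, bElt_mul_shiftElt h₁.symm,
      bElt_mul_bElt_mk] at this
    convert this using 3
    funext c
    have e₁ := coe_texp x z₂ z₁ c
    have e₂ := coe_texp x z₁ z₀ c
    have e₃ := coe_texp x z₀ y c
    have := hb (c.val + 1)
    omega

/-- An intermediate state with two consecutive free positions at the left end of a generating
interval, making a detour only on the remaining strands of the interval. -/
lemma exists_interval_state {x y : IdemState m k} {p q : ℤ}
    (h : HeightInterval (height x.1) (height y.1) p q) (hp : 0 ≤ p) (hq : q ≤ m) :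
    ∃ z : IdemState m k, ¬Occ (height z.1) p ∧ ¬Occ (height z.1) (p + 1) ∧
      (∀ a, p + 1 < a → a ≤ q → height z.1 a = height x.1 a + 1) ∧
      ∀ a, a ≤ p + 1 ∨ q < a → min (height x.1 a) (height y.1 a) ≤ height z.1 a ∧
        height z.1 a ≤ max (height x.1 a) (height y.1 a) := by
  have hx := isHeight_height x
  have hy := isHeight_height y
  have hlt := h.lt
  have hl := h.left
  have hr := h.right
  have hin := h.inner
  have heq := h.eq
  unfold Occ at hl hr hin
  generalize height x.1 = u at *
  generalize height y.1 = v at *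
  have a₁ := heq (p + 1) (by omega) (by omega)
  have a₂ := heq q (by omega) (by omega)
  have b₁ := hx.succ_le p
  have b₂ := hy.succ_le p
  have b₃ := hx.le_succ p
  have b₄ := hy.le_succ p
  have b₅ := hx.succ_le q
  have b₆ := hy.succ_le q
  have b₇ := hx.le_succ q
  have b₈ := hy.le_succ q
  let f : ℤ → ℤ := fun a =>
    if a ≤ p + 1 then max (min (u a) (v a)) (min (max (u a) (v a)) (u (p + 1)))
    else if a ≤ q then u a + 1 else max (min (u a) (v a)) (min (max (u a) (v a)) (u q))
  have hf₁ : ∀ a ≤ p + 1, f a = max (min (u a) (v a)) (min (max (u a) (v a)) (u (p + 1))) :=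
    fun a ha => if_pos ha
  have hf₂ : ∀ a, p + 1 < a → a ≤ q → f a = u a + 1 :=
    fun a ha ha' => (if_neg (not_le.2 ha)).trans (if_pos ha')
  have hf₃ : ∀ a, q < a → f a = max (min (u a) (v a)) (min (max (u a) (v a)) (u q)) :=
    fun a ha => (if_neg (by omega)).trans (if_neg (by omega))
  clear_value f
  have hstep : ∀ a, f (a + 1) ≤ f a ∧ f a ≤ f (a + 1) + 1 := by
    intro a
    have c₁ := hx.succ_le a
    have c₂ := hy.succ_le a
    have c₃ := hx.le_succ a
    have c₄ := hy.le_succ a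
    have c₅ := hin a
    rcases lt_trichotomy a (p + 1) with d | rfl | d
    · rw [hf₁ a (by omega), hf₁ (a + 1) (by omega)]
      omega
    · rcases (Int.add_one_le_of_lt hlt).eq_or_lt with rfl | d
      · rw [hf₁ (p + 1) le_rfl, hf₃ (p + 1 + 1) (by omega)]
        omega
      · rw [hf₁ (p + 1) le_rfl, hf₂ (p + 1 + 1) (by omega) (by omega)]
        omega
    rcases lt_trichotomy a q with d' | rfl | d'
    · rw [hf₂ a d d'.le, hf₂ (a + 1) (by omega) (by omega)]
      omega
    · rw [hf₂ a d le_rfl, hf₃ (a + 1) (by omega)]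
      omega
    · rw [hf₃ a d', hf₃ (a + 1) (by omega)]
      omega
  obtain ⟨z, hz⟩ := exists_height_eq (u := f) (m := m) (k := k)
    ⟨fun a => (hstep a).1, fun a => (hstep a).2, fun a ha => by
      have c₁ := hx.left a ha
      have c₂ := hy.left a ha
      rw [hf₁ a (by omega)]
      omega, fun a ha => by
      have c₁ := hx.right a ha
      have c₂ := hy.right a ha
      rw [hf₃ a (by omega)]
      omega⟩
  refine ⟨z, ?_, ?_, fun a h₁ h₂ => ?_, fun a ha => ?_⟩ <;> rw [hz]
  · rw [Occ, hf₁ p (by omega), hf₁ (p + 1) le_rfl]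
    omega
  · rw [Occ, hf₁ (p + 1) le_rfl]
    rcases (Int.add_one_le_of_lt hlt).eq_or_lt with rfl | d
    · rw [hf₃ (p + 1 + 1) (by omega)]
      omega
    · have c₅ := hin (p + 1) (by omega) d
      have c₆ := hx.le_succ (p + 1)
      rw [hf₂ (p + 1 + 1) (by omega) (by omega)]
      omega
  · exact hf₂ a h₁ h₂
  · rcases ha with ha | ha
    · rw [hf₁ a ha]
      omega
    · rw [hf₃ a ha]
      omega

lemma bElt_mem_JIdeal_of_zero {a : BGen m k} (h : a.Zero) : bElt a ∈ JIdeal m k := by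
  obtain ⟨x, y, s⟩ := a
  obtain h | ⟨p, q, h, hS⟩ := h
  · exact bElt_mem_JIdeal_of_far h
  dsimp only at h hS
  have hlt := h.lt
  obtain ⟨j, hj, hsj⟩ := hS (p + 1) (by omega) (by omega)
  obtain ⟨j', hj', -⟩ := hS q (by omega) le_rfl
  obtain ⟨z, h₁, h₂, h₃, h₄⟩ := exists_interval_state h (by omega) (by omega)
  obtain rfl : p = j.val := by omega
  have hg : idemElt z * UElt j ∈ JGenerators m k := by
    refine Or.inr ⟨j, z, fun hz => h₁ ((occ_height (b := j.castSucc)).2 hz), fun hz => h₂ ?_, rfl⟩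
    have := (occ_height (b := j.succ)).2 hz
    rw [Fin.val_succ] at this
    exact_mod_cast this
  have := mul_mul_mem_JIdeal hg
    (bElt ⟨x, z, fun c => s c - (if c = j then 1 else 0) - texp x z y c⟩)
    (bElt ⟨z, y, fun _ => 0⟩)
  rw [idemElt, bElt_mul_UElt, bElt_mul_bElt_mk, bElt_mul_bElt_mk] at this
  convert this using 3
  funext c
  simp only [texp_right]
  have e := coe_texp x z y c
  by_cases hc : (j.val : ℤ) < c.val + 1 ∧ (c.val : ℤ) + 1 ≤ q
  · obtain ⟨c', hc', hs⟩ := hS _ hc.1 hc.2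
    obtain rfl : c = c' := Fin.ext (by omega)
    have e₁ := h.eq _ hc.1 hc.2
    by_cases hcj : c = j
    · subst hcj
      have := h₄ (c.val + 1) (by omega)
      simp only [if_true]
      omega
    · have := h₃ (c.val + 1) (by have := Fin.val_ne_of_ne hcj; omega) hc.2
      simp only [hcj, if_false]
      omega
  · have hcj : c ≠ j := by
      rintro rfl
      omega
    have := h₄ (c.val + 1) (by omega)
    simp only [hcj, if_false]
    omega

/-- A basis element lies in `J` exactly when its end states are far or its monomial is divisible
by the monomial of a generating interval. -/
lemma bElt_mem_JIdeal_iff {a : BGen m k} : bElt a ∈ JIdeal m k ↔ a.Zero :=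
  ⟨fun h => zero_of_bElt_mem_zeroSpan (JIdeal_le_zeroSpan h), bElt_mem_JIdeal_of_zero⟩

lemma height_eq_of_two_dvd_wnum {x y : IdemState m k} {i : Fin m} (hi : 2 ∣ wnum x.1 y.1 i)
    (h : ¬FarHeights (height x.1) (height y.1)) :
    height x.1 (i.val + 1) = height y.1 (i.val + 1) := by
  have h₁ := coe_wnum x.1 y.1 i
  have h₂ := (isHeight_height x).le_succ (i.val + 1)
  have h₃ := (isHeight_height y).le_succ (i.val + 1)
  have h₄ : ¬(height x.1 (i.val + 1) < height y.1 (i.val + 1 + 1) ∨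
    height y.1 (i.val + 1) < height x.1 (i.val + 1 + 1)) := fun h' => h ⟨_, h'⟩
  rcases abs_cases (height x.1 (i.val + 1) - height y.1 (i.val + 1)) with h₅ | h₅ <;> omega

lemma strands_add_single (s : Fin m → ℕ) (i : Fin m) :
    strands (fun c => s c + if c = i then 1 else 0) ⊆ insert ((i.val : ℤ) + 1) (strands s) := by
  rintro _ ⟨c, rfl, hc⟩
  by_cases h : c = i
  · exact Or.inl (by rw [h])
  · exact Or.inr ⟨c, rfl, by simpa [h] using hc⟩

lemma vanishes_of_isShift {ε : ℤ} {i : Fin m} {x y z : IdemState m k} {s : Fin m → ℕ}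
    (hε : ε = 1 ∨ ε = -1) (hi : 2 ∣ wnum x.1 y.1 i) (hyz : IsShift ε i y z)
    (h : ¬BGen.Zero ⟨x, y, s⟩)
    (hU : BGen.Zero ⟨x, y, fun c => s c + if c = i then 1 else 0⟩) :
    Vanishes (height x.1) (height z.1) (strands s) := by
  refine (Vanishes.shift (isHeight_height x) (isHeight_height y) (isHeight_height z)
    (fun a ha => ?_) ?_ (height_eq_of_two_dvd_wnum hi fun h' => h (Or.inl h'))
    (hU.mono (strands_add_single s i))).resolve_left h
  · rw [hyz, if_neg ha, add_zero]
  · rw [hyz, if_pos rfl]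
    omega

end Ideal

/-- Let `a ∈ B(m,k) = B₀(m,k)/J` be a nonzero
weight-homogeneous element (the class of a basis element `φ^{x,y}(U^s)` not
lying in `J`) whose `i`-th weight `w_i(a) = ½·wnum + s_i` is an integer
(i.e. `2 ∣ wnum x y i`).  If `a·R_i ≠ 0` then `a·U_i ≠ 0`; similarly, if
`R_i·a ≠ 0` then `U_i·a ≠ 0`.  (An element of the quotient is nonzero exactly
when a representative does not lie in `J`; here the index `i : Fin m`
corresponds to the paper's `R_{i+1}`, `U_{i+1}` and `w_{i+1}`.) -/
theorem homogeneous_R_nonzero_implies_U_nonzero (m k : ℕ) (hk : k ≤ m + 1)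
    (x y : IdemState m k) (s : Fin m → ℕ) (i : Fin m)
    (hint : 2 ∣ wnum x.1 y.1 i)
    (ha : bElt (⟨x, y, s⟩ : BGen m k) ∉ JIdeal m k) :
    (bElt (⟨x, y, s⟩ : BGen m k) * RElt i ∉ JIdeal m k →
      bElt (⟨x, y, s⟩ : BGen m k) * UElt i ∉ JIdeal m k) ∧
    (RElt i * bElt (⟨x, y, s⟩ : BGen m k) ∉ JIdeal m k →
      UElt i * bElt (⟨x, y, s⟩ : BGen m k) ∉ JIdeal m k) := by
  rw [bElt_mul_UElt, UElt_mul_bElt, RElt_eq]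
  simp only [bElt_mem_JIdeal_iff] at ha ⊢
  refine ⟨mt fun hU => ?_, mt fun hU => ?_⟩
  · by_cases h : ∃ z, IsShift 1 i y z
    · obtain ⟨z, hz⟩ := h
      rw [bElt_mul_shiftElt hz, bElt_mem_JIdeal_iff]
      exact (vanishes_of_isShift (Or.inl rfl) hint hz ha hU).mono
        (strands_mono fun c => Nat.le_add_right _ _)
    · push Not at h
      rw [bElt_mul_shiftElt_eq_zero h]
      exact zero_mem _
  · by_cases h : ∃ z, IsShift 1 i z x
    · obtain ⟨z, hz⟩ := h
      rw [shiftElt_mul_bElt hz, bElt_mem_JIdeal_iff]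
      have hint' : 2 ∣ wnum y.1 x.1 i := by
        rwa [wnum, ← Int.natAbs_neg, neg_sub]
      exact ((vanishes_of_isShift (Or.inr rfl) hint' hz.symm (fun h => ha (Vanishes.symm h))
        (Vanishes.symm hU)).mono (strands_mono fun c => Nat.le_add_right _ _)).symm
    · push Not at h
      rw [shiftElt_mul_bElt_eq_zero h]
      exact zero_mem _
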